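/- Let A ⊆ ℕ, let 0 < α1 < 1 < α2, β ∈ (0,1), M ≥ 0, Ω ≥ 0, and suppose: (i) for all j ≤ k, #(A ∩ {j,…,k}) ≤ M + β·(k−j); (ii) e: ℕ → ℝ is a nonnegative sequence with e(k+1) ≤ α2·e(k) + Ω if k ∈ A and e(k+1) ≤ α1·e(k) + Ω if k ∉ A; (iii) β < −ln α1/(ln α2 − ln α1), i.e., c := ln α1 + β·(ln α2 − ln α1) < 0. Then for every k ∈ ℕ, e(k+1) ≤ exp((ln α2 − ln α1)·M)·exp(c·k)·e(0) + (exp((ln α2 − ln α1)·M)/(1 − exp(c)))·Ω. Consequently e is uniformly ultimately bounded: limsup_{k→∞} e(k) ≤ B_t := exp((ln α2 − ln α1)·M)·Ω/(1 − exp(c)). -/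

import Mathlib

/-- Theorem 1 (scalar form): UUB of the twin-layer tracking error under DoS attacks. -/
theorem twin_layer_uub (A : Set ℕ) [DecidablePred (· ∈ A)]
    (α1 α2 β M Ω : ℝ)
    (h1 : 0 < α1) (h2 : α1 < 1) (h3 : 1 < α2)
    (hβ0 : 0 < β) (hβ1 : β < 1) (hM : 0 ≤ M) (hΩ : 0 ≤ Ω)
    (hA : ∀ j k : ℕ, j ≤ k →
      (((Finset.Icc j k).filter (· ∈ A)).card : ℝ) ≤ M + β * ((k : ℝ) - j))
    (e : ℕ → ℝ) (hen : ∀ k, 0 ≤ e k)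
    (hrec : ∀ k, (k ∈ A → e (k + 1) ≤ α2 * e k + Ω) ∧
                 (k ∉ A → e (k + 1) ≤ α1 * e k + Ω))
    (hβc : β < -Real.log α1 / (Real.log α2 - Real.log α1)) :
    (∀ k : ℕ, e (k + 1) ≤
        Real.exp ((Real.log α2 - Real.log α1) * M) *
            Real.exp ((Real.log α1 + β * (Real.log α2 - Real.log α1)) * k) * e 0
          + (Real.exp ((Real.log α2 - Real.log α1) * M) /
              (1 - Real.exp (Real.log α1 + β * (Real.log α2 - Real.log α1)))) * Ω) ∧
    Filter.limsup e Filter.atTop ≤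
      Real.exp ((Real.log α2 - Real.log α1) * M) * Ω /
        (1 - Real.exp (Real.log α1 + β * (Real.log α2 - Real.log α1))) := by
  set L : ℝ := Real.log α2 - Real.log α1 with hL
  set c : ℝ := Real.log α1 + β * L with hc
  have hlog : Real.log α1 < Real.log α2 := Real.log_lt_log h1 (h2.trans h3)
  have hLpos : 0 < L := sub_pos.mpr hlog
  have hcneg : c < 0 := by
    have := (lt_div_iff₀ hLpos).1 hβc
    linarith
  have hr0 : 0 < Real.exp c := Real.exp_pos c
  have hr1 : Real.exp c < 1 := Real.exp_lt_one_iff.mpr hcneg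
  have hE1 : 1 ≤ Real.exp (L * M) := Real.one_le_exp (by positivity)
  set E : ℝ := Real.exp (L * M) with hE
  set r : ℝ := Real.exp c with hr
  have hα2 : 0 < α2 := by linarith
  let a : ℕ → ℝ := fun k => if k ∈ A then α2 else α1
  have ha0 : ∀ k, 0 < a k := by
    intro k
    simp only [a]
    split_ifs <;> assumption
  have hae : ∀ k, a k = Real.exp (Real.log α1 + L * (if k ∈ A then 1 else 0)) := by
    intro k
    simp only [a]
    split_ifs
    · rw [hL, mul_one, add_sub_cancel, Real.exp_log hα2]
    · rw [mul_zero, add_zero, Real.exp_log h1]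
  have hstep : ∀ k, e (k + 1) ≤ a k * e k + Ω := by
    intro k
    by_cases hk : k ∈ A
    · simpa [a, hk] using (hrec k).1 hk
    · simpa [a, hk] using (hrec k).2 hk
  let P : ℕ → ℕ → ℝ := fun j n => ∏ i ∈ Finset.range n, a (j + i)
  have hP0 : ∀ j n, 0 ≤ P j n := fun j n => Finset.prod_nonneg fun i _ => (ha0 _).le
  have hPeq : ∀ j n, P j (n + 1) = Real.exp (Real.log α1 * (n + 1) +
      L * (((Finset.Icc j (j + n)).filter (· ∈ A)).card : ℝ)) := by
    intro j n
    induction n with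
    | zero =>
      simp only [P, Finset.prod_range_succ, Finset.prod_range_zero, one_mul, add_zero, hae]
      by_cases hj : j ∈ A <;> simp [hj, Finset.filter_singleton]
    | succ n ih =>
      have h5 : P j (n + 1 + 1) = P j (n + 1) * a (j + (n + 1)) := Finset.prod_range_succ _ _
      have h6 : Finset.Icc j (j + (n + 1)) = insert (j + (n + 1)) (Finset.Icc j (j + n)) := by
        ext x
        simp only [Finset.mem_Icc, Finset.mem_insert]
        omega
      have h7 : j + (n + 1) ∉ (Finset.Icc j (j + n)).filter (· ∈ A) := by
        simp
      rw [h5, ih, hae, ← Real.exp_add, h6, Finset.filter_insert]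
      congr 1
      split_ifs
      · rw [Finset.card_insert_of_notMem h7]
        push_cast
        ring
      · push_cast
        ring
  have hP : ∀ j n, P j n ≤ E * r ^ n := by
    intro j n
    cases n with
    | zero => simpa [P] using hE1
    | succ n =>
      rw [hPeq, hE, hr, ← Real.exp_nat_mul, ← Real.exp_add]
      apply Real.exp_le_exp.2
      have h5 := hA j (j + n) (by omega)
      have h6 := mul_le_mul_of_nonneg_left h5 hLpos.le
      have h7 : 0 < L * β := by positivity
      push_cast at h6 ⊢
      rw [hc]
      nlinarith
  have hmain : ∀ n j, e (j + n) ≤ P j n * e j + Ω * ∑ i ∈ Finset.range n, E * r ^ i := by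
    intro n
    induction n with
    | zero => intro j; simp [P]
    | succ n ih =>
      intro j
      have h5 := ih (j + 1)
      have h6 : P j (n + 1) = P (j + 1) n * a j := by
        simp only [P, Finset.prod_range_succ', add_zero]
        congr 1
        apply Finset.prod_congr rfl
        intro i _
        congr 1
        omega
      have h7 := mul_le_mul_of_nonneg_left (hstep j) (hP0 (j + 1) n)
      have h8 := mul_le_mul_of_nonneg_right (hP (j + 1) n) hΩ
      rw [show j + (n + 1) = j + 1 + n by omega, h6, Finset.sum_range_succ]
      linarith
  have hd : 0 < 1 - r := by linarith
  have hsum : ∀ n, ∑ i ∈ Finset.range n, E * r ^ i ≤ E / (1 - r) := by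
    intro n
    rw [← Finset.mul_sum, le_div_iff₀ hd, mul_assoc, geom_sum_mul_neg]
    have : 0 < r ^ n := by positivity
    nlinarith
  have hfin : ∀ n, e n ≤ E * r ^ n * e 0 + E / (1 - r) * Ω := by
    intro n
    have h5 := hmain n 0
    rw [zero_add] at h5
    have h6 := mul_le_mul_of_nonneg_right (hP 0 n) (hen 0)
    have h7 := mul_le_mul_of_nonneg_left (hsum n) hΩ
    linarith
  constructor
  · intro k
    refine (hfin (k + 1)).trans ?_
    have h5 : Real.exp (c * k) = r ^ k := by rw [hr, ← Real.exp_nat_mul, mul_comm]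
    have h6 : r ^ (k + 1) ≤ r ^ k := pow_le_pow_of_le_one hr0.le hr1.le (Nat.le_succ k)
    rw [h5]
    have h7 := hen 0
    gcongr
  · apply le_of_forall_pos_le_add
    intro ε hε
    have ht : Filter.Tendsto (fun n : ℕ => E * r ^ n * e 0) Filter.atTop (nhds 0) := by
      have := ((tendsto_pow_atTop_nhds_zero_of_lt_one hr0.le hr1).const_mul E).mul_const (e 0)
      simpa using this
    have hev := ht.eventually (gt_mem_nhds hε)
    refine Filter.limsup_le_of_le ?_ ?_
    · exact Filter.IsCoboundedUnder.of_frequently_ge (a := 0)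
        (Filter.Frequently.of_forall hen)
    · filter_upwards [hev] with n hn
      have h5 := hfin n
      have h6 : E * Ω / (1 - r) = E / (1 - r) * Ω := by ring
      rw [h6]
      linarith
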